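/- The greatest integer n > 10 such that for every integer k with 2 ≤ k² ≤ n/2, the remainder of n upon division by k² is odd, equals 505. -/

import Mathlib

theorem small_case : ∀ n < 676, 505 < n →
    ∃ k < 19, 2 ≤ k ∧ 2 * k ^ 2 ≤ n ∧ n % k ^ 2 % 2 = 0 := by
  decide +kernel

theorem stmt_0 :
    IsGreatest {n : ℕ | 10 < n ∧ ∀ k : ℕ, 2 ≤ k → 2 * k ^ 2 ≤ n → Odd (n % k ^ 2)} 505 := by
  constructor
  · refine ⟨by norm_num, fun k h2 hk => ?_⟩
    have : k < 16 := by nlinarith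
    interval_cases k <;> first | decide | omega
  · rintro n ⟨_, h⟩
    by_contra hn
    push Not at hn
    by_cases hs : n < 676
    · obtain ⟨k, _, h2, hk, he⟩ := small_case n hs hn
      have := Nat.odd_iff.mp (h k h2 hk)
      omega
    · have h1 : Nat.sqrt n * Nat.sqrt n ≤ n := Nat.sqrt_le n
      have h3 : n < (Nat.sqrt n + 1) * (Nat.sqrt n + 1) := Nat.lt_succ_sqrt n
      have hm : 26 ≤ Nat.sqrt n := Nat.le_sqrt.mpr (by omega)
      generalize Nat.sqrt n = m at *
      obtain ⟨j, hj1, hj2⟩ : ∃ j, m + 1 ≤ 4 * j + 2 ∧ 4 * j + 2 ≤ m + 4 :=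
        ⟨(m + 2) / 4, by omega, by omega⟩
      have a1 : n < 4 * (2 * j + 1) ^ 2 := by nlinarith
      have a2 : 3 * (2 * j + 1) ^ 2 ≤ n := by nlinarith
      have hodd := Nat.odd_iff.mp (h 2 (by norm_num) (by omega))
      have hk := Nat.odd_iff.mp (h (2 * j + 1) (by omega) (by omega))
      have hq : (2 * j + 1) ^ 2 % 2 = 1 := by
        rw [show (2 * j + 1) ^ 2 = 2 * (2 * j ^ 2 + 2 * j) + 1 by ring]; omega
      generalize (2 * j + 1) ^ 2 = q at *
      have hr : n % q = n - 3 * q := by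
        rw [Nat.mod_eq_iff]
        right
        exact ⟨by omega, 3, by omega⟩
      omega
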